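/- arXiv:2410.21755 — 3 statements merged into one kernel-verified Lean document; each statement's English description precedes it below -/
import Mathlib

section
/- Let R be a commutative ring and A an associative R-algebra with a ℤ/2-grading A = A₀ ⊕ A₁ (AᵢAⱼ ⊆ A_{i+j}). Let X, Y, Z ∈ A be homogeneous with parities [X], [Y], [Z] ∈ {0,1}, let μ, ω ∈ R and let ν ∈ R be a unit. Then [[X, Y]_μ, Z]_ω = [X, [Y, Z]_ν]_{μων⁻¹} + (−1)^{[Y][Z]} ν [[X, Z]_{ων⁻¹}, Y]_{μν⁻¹}. -/
noncomputable section

/-- the `μ`-twisted superbracket `[X, Y]_μ = XY - (-1)^{[X][Y]} μ YX`, where `s = [X][Y]`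
is the product of the parities of the homogeneous elements `X`, `Y`. -/
def superBr {R A : Type*} [CommRing R] [Ring A] [Algebra R A]
    (s : ZMod 2) (μ : R) (X Y : A) : A :=
  X * Y - ((-1 : R) ^ s.val * μ) • (Y * X)

/-- The sign `(-1)^a`, for `a : ZMod 2`, turns sums into products. -/
theorem neg_one_pow_val_add {R : Type*} [CommRing R] (a b : ZMod 2) :
    (-1 : R) ^ (a + b).val = (-1) ^ a.val * (-1) ^ b.val := by
  rw [ZMod.val_add, ← pow_add, ← neg_one_pow_eq_pow_mod_two]

/-- The Jacobi-like identity for twisted commutators with arbitrary signs `a`, `b`, `c`,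
of which only `c` needs to square to one. -/
theorem twisted_commutator_jacobi {R A : Type*} [CommRing R] [Ring A] [Algebra R A]
    (X Y Z : A) (a b c μ ω ν ν' : R) (hc : c * c = 1) (hν : ν * ν' = 1) :
    (X * Y - (a * μ) • (Y * X)) * Z - (b * c * ω) • (Z * (X * Y - (a * μ) • (Y * X)))
      = X * (Y * Z - (c * ν) • (Z * Y))
          - (a * b * (μ * ω * ν')) • ((Y * Z - (c * ν) • (Z * Y)) * X)
        + (c * ν) • ((X * Z - (b * (ω * ν')) • (Z * X)) * Y
          - (a * c * (μ * ν')) • (Y * (X * Z - (b * (ω * ν')) • (Z * X)))) := by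
  simp only [sub_mul, mul_sub, smul_mul_assoc, mul_smul_comm, mul_assoc]
  match_scalars
  · ring
  · linear_combination a * μ * hc + c * c * a * μ * hν
  · linear_combination b * c * ω * hν
  · linear_combination -(a * b * c * μ * ω) * hν
  · ring
  · linear_combination -(a * b * μ * ω * ν') * (hc + c * c * hν)

/-- for a `ℤ/2`-graded associative `R`-algebra `A` and homogeneous
`X, Y, Z` of parities `px, py, pz`, scalars `μ, ω` and a unit `ν`,
`[[X,Y]_μ, Z]_ω = [X, [Y,Z]_ν]_{μων⁻¹} + (-1)^{[Y][Z]} ν [[X,Z]_{ων⁻¹}, Y]_{μν⁻¹}`. -/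
theorem jacobi_like_superbracket₁ {R A : Type*} [CommRing R] [Ring A] [Algebra R A]
    (𝒜 : ZMod 2 → Submodule R A) [GradedAlgebra 𝒜]
    (px py pz : ZMod 2) (X Y Z : A)
    (hX : X ∈ 𝒜 px) (hY : Y ∈ 𝒜 py) (hZ : Z ∈ 𝒜 pz)
    (μ ω : R) (ν : Rˣ) :
    superBr ((px + py) * pz) ω (superBr (px * py) μ X Y) Z
      = superBr (px * (py + pz)) (μ * ω * (↑ν⁻¹ : R)) X (superBr (py * pz) (↑ν : R) Y Z)
        + ((-1 : R) ^ (py * pz).val * (↑ν : R)) •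
            superBr ((px + pz) * py) (μ * (↑ν⁻¹ : R))
              (superBr (px * pz) (ω * (↑ν⁻¹ : R)) X Z) Y := by
  have hc : (-1 : R) ^ (py * pz).val * (-1 : R) ^ (py * pz).val = 1 := by
    rw [← mul_pow]
    simp
  simp only [superBr, add_mul, mul_add, neg_one_pow_val_add, mul_comm pz py]
  exact twisted_commutator_jacobi X Y Z _ _ _ μ ω ν _ hc ν.mul_inv
end
end

section
/- Let R be a commutative ring and A an associative R-algebra with a ℤ/2-grading A = A₀ ⊕ A₁ (AᵢAⱼ ⊆ A_{i+j}). Let X, Y, Z ∈ A be homogeneous with parities [X], [Y], [Z] ∈ {0,1}, let μ, ω ∈ R and let ν ∈ R be a unit. Then [X, [Y, Z]_μ]_ω = [[X, Y]_ν, Z]_{μων⁻¹} + (−1)^{[X][Y]} ν [Y, [X, Z]_{ων⁻¹}]_{μν⁻¹}. -/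
noncomputable section

theorem neg_one_pow_mul_self {R : Type*} [CommRing R] (n : ℕ) :
    (-1 : R) ^ n * (-1) ^ n = 1 := by
  rw [← mul_pow, neg_one_mul, neg_neg, one_pow]

/-- for a `ℤ/2`-graded associative `R`-algebra `A` and homogeneous
`X, Y, Z` of parities `px, py, pz`, scalars `μ, ω` and a unit `ν`,
`[X, [Y,Z]_μ]_ω = [[X,Y]_ν, Z]_{μων⁻¹} + (-1)^{[X][Y]} ν [Y, [X,Z]_{ων⁻¹}]_{μν⁻¹}`. -/
theorem jacobi_like_superbracket₂ {R A : Type*} [CommRing R] [Ring A] [Algebra R A]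
    (𝒜 : ZMod 2 → Submodule R A) [GradedAlgebra 𝒜]
    (px py pz : ZMod 2) (X Y Z : A)
    (hX : X ∈ 𝒜 px) (hY : Y ∈ 𝒜 py) (hZ : Z ∈ 𝒜 pz)
    (μ ω : R) (ν : Rˣ) :
    superBr (px * (py + pz)) ω X (superBr (py * pz) μ Y Z)
      = superBr ((px + py) * pz) (μ * ω * (↑ν⁻¹ : R)) (superBr (px * py) (↑ν : R) X Y) Z
        + ((-1 : R) ^ (px * py).val * (↑ν : R)) •
            superBr (py * (px + pz)) (μ * (↑ν⁻¹ : R)) Y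
              (superBr (px * pz) (ω * (↑ν⁻¹ : R)) X Z) := by
  have hν : (ν : R) * (↑ν⁻¹ : R) = 1 := ν.mul_inv
  have hxy := neg_one_pow_mul_self (R := R) (px * py).val
  simp only [superBr, mul_add, add_mul, neg_one_pow_val_add, mul_comm py px]
  generalize (-1 : R) ^ (px * py).val = a at *
  generalize (-1 : R) ^ (px * pz).val = b
  generalize (-1 : R) ^ (py * pz).val = c
  generalize (↑ν⁻¹ : R) = κ at *
  generalize (ν : R) = n at *
  simp only [mul_sub, sub_mul, smul_sub, mul_smul_comm, smul_mul_assoc, smul_smul, mul_assoc]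
  match_scalars <;> grind
end
end

section
/- There exists a ℂ-linear bijection Ω : U → U satisfying Ω(XY) = Ω(Y)Ω(X) for all X, Y ∈ U, Ω(f(v)·x) = f(v^{−1})·Ω(x) for all f ∈ ℂ(v) and x ∈ U, and Ω(χ_i^±) = d_{i+1}χ_i^∓ for 0 ≤ i ≤ N, Ω(K_i^{±1}) = K_i^{∓1} for 0 ≤ i ≤ N, Ω(K_δ^{±1/2}) = K_δ^{∓1/2}, where d_i = (ε_i, ε_i) for 1 ≤ i ≤ N and d_{N+1} = 1. -/
noncomputable section

open Finset

/-- The base field `K = ℂ(v)`, with `v = q^{1/2}`. -/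
abbrev KK : Type := RatFunc ℂ

/-- The variable `v = q^{1/2}`; thus `q^{a} = vv ^ (2*a)`. -/
def vv : KK := RatFunc.X

/-- `(ε_{k+1}, ε_{k+1})` for `0 ≤ k < N` (0-indexed). -/
def epsSq (n k : ℕ) : ℤ := if k < n then -1 else 1

/-- coefficient of `ε_{k+1}` (0-indexed `k`) in the simple root `α_i`, `0 ≤ i ≤ m+n`. -/
def co (m n i k : ℕ) : ℤ :=
  if i = 0 then (if k = 0 then -2 else 0)
  else if i = m + n then (if k + 1 = m + n then 1 else 0)
  else (if k + 1 = i then 1 else 0) - (if k = i then 1 else 0)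

/-- `(α_i, α_j)`. -/
def Bmat (m n i j : ℕ) : ℤ :=
  ∑ k ∈ Finset.range (m + n), epsSq n k * co m n i k * co m n j k

/-- Bilinear form on weights written in the `α`-basis (coords `ℕ → ℤ`). -/
def Bw (m n : ℕ) (a b : ℕ → ℤ) : ℤ :=
  ∑ i ∈ Finset.range (m + n + 1), ∑ j ∈ Finset.range (m + n + 1), a i * b j * Bmat m n i j

/-- the weight `α_i` in `α`-coordinates. -/
def uw (i : ℕ) : ℕ → ℤ := fun j => if j = i then 1 else 0

/-- the sign `(-1)^{[a][b]}`: the parity of a weight `a` is `a n mod 2`. -/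
def sg (n : ℕ) (a b : ℕ → ℤ) : KK := (-1 : KK) ^ (a n * b n)

/-- the coefficient `(-1)^{[a][b]} q^{-(a,b)}` appearing in `⟦·,·⟧`. -/
def qcf (m n : ℕ) (a b : ℕ → ℤ) : KK := sg n a b * vv ^ (-2 * Bw m n a b)

/-- `q_i = vv ^ qexp i`. -/
def qexp (m n i : ℕ) : ℤ := if Bmat m n i i = 0 then 2 else |Bmat m n i i|

/-- the quantum integer `[a]_i`. -/
def qint (m n i : ℕ) (a : ℤ) : KK :=
  (vv ^ (qexp m n i * a) - vv ^ (-(qexp m n i * a))) / (vv ^ qexp m n i - vv ^ (-qexp m n i))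

/-- the matrix `A_{ij}`. -/
def Amat (m n i j : ℕ) : ℤ := if i = m + n then 2 * Bmat m n i j else Bmat m n i j

section brackets
variable {A : Type*} [Ring A] [Algebra KK A]

/-- `[x, y]_c = x y - c • (y x)`. -/
def cbr (c : KK) (x y : A) : A := x * y - c • (y * x)

/-- supercommutator of homogeneous elements of weights `a`, `b`. -/
def sbr (n : ℕ) (a b : ℕ → ℤ) (x y : A) : A := cbr (sg n a b) x y

/-- the bracket `⟦x, y⟧` for homogeneous elements of weights `a`, `b`. -/
def qbr (m n : ℕ) (a b : ℕ → ℤ) (x y : A) : A := cbr (qcf m n a b) x y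

end brackets

/-- total weight of a list of simple-root indices. -/
def lwt (l : List ℕ) : ℕ → ℤ := l.foldr (fun j w => uw j + w) 0

/-- right-nested `⟦·,⟦·,…⟧⟧` of a list of simple root vectors `e j`. -/
def qfoldr (m n : ℕ) {A : Type*} [Ring A] [Algebra KK A] (e : ℕ → A) : List ℕ → A
  | [] => 1
  | [j] => e j
  | j :: rest => qbr m n (uw j) (lwt rest) (e j) (qfoldr m n e rest)

/-! ## The Drinfeld–Jimbo presentation `U = U_q[osp(2m+1|2n)^{(1)}]` -/

/-- Generators of `U`. -/
inductive UGen (m n : ℕ) : Type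
  | cp (i : Fin (m + n + 1))   -- χ_i⁺
  | cm (i : Fin (m + n + 1))   -- χ_i⁻
  | kk (i : Fin (m + n + 1))   -- K_i
  | ki (i : Fin (m + n + 1))   -- K_i⁻¹
  | kd                          -- K_δ^{1/2}
  | kdi                         -- K_δ^{-1/2}

/-- Free algebra on the generators of `U`. -/
abbrev UF (m n : ℕ) : Type := FreeAlgebra KK (UGen m n)

def uidx (m n : ℕ) (i : ℕ) : Fin (m + n + 1) := ⟨i % (m + n + 1), Nat.mod_lt _ (Nat.succ_pos _)⟩

def fcp (m n : ℕ) (i : ℕ) : UF m n := FreeAlgebra.ι KK (UGen.cp (uidx m n i))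
def fcm (m n : ℕ) (i : ℕ) : UF m n := FreeAlgebra.ι KK (UGen.cm (uidx m n i))
def fk (m n : ℕ) (i : ℕ) : UF m n := FreeAlgebra.ι KK (UGen.kk (uidx m n i))
def fki (m n : ℕ) (i : ℕ) : UF m n := FreeAlgebra.ι KK (UGen.ki (uidx m n i))
def fkd (m n : ℕ) : UF m n := FreeAlgebra.ι KK (UGen.kd)
def fkdi (m n : ℕ) : UF m n := FreeAlgebra.ι KK (UGen.kdi)
/-- `χ_i^σ`, `σ = true` for `+`. -/
def fx (m n : ℕ) (σ : Bool) (i : ℕ) : UF m n := if σ then fcp m n i else fcm m n i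

/-- left-hand side of DJ9. -/
def dj9lhs (m n : ℕ) (σ : Bool) : UF m n :=
  sbr n (uw 3 + uw 2 + uw 1 + uw 0 + uw 1 + uw 2) (uw 1)
   (qbr m n (uw 3 + uw 2 + uw 1 + uw 0 + uw 1) (uw 2)
    (qbr m n (uw 3 + uw 2 + uw 1 + uw 0) (uw 1)
     (qbr m n (uw 3 + uw 2 + uw 1) (uw 0)
      (qbr m n (uw 3 + uw 2) (uw 1)
       (qbr m n (uw 3) (uw 2) (fx m n σ 3) (fx m n σ 2))
       (fx m n σ 1))
      (fx m n σ 0))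
     (fx m n σ 1))
    (fx m n σ 2))
   (fx m n σ 1)

/-- `⟦χ_2^σ, χ_1^σ⟧`. -/
def dj10A (m n : ℕ) (σ : Bool) : UF m n := qbr m n (uw 2) (uw 1) (fx m n σ 2) (fx m n σ 1)

/-- left-hand side of DJ10. -/
def dj10lhs (m n : ℕ) (σ : Bool) : UF m n :=
  qbr m n (uw 2 + uw 1) ((uw 2 + uw 1) + ((uw 2 + uw 1) + uw 0)) (dj10A m n σ)
   (qbr m n (uw 2 + uw 1) ((uw 2 + uw 1) + uw 0) (dj10A m n σ)
    (qbr m n (uw 2 + uw 1) (uw 0) (dj10A m n σ) (fx m n σ 0)))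

/-- right-hand side of DJ10 (without the scalar). -/
def dj10rhs (m n : ℕ) (σ : Bool) : UF m n :=
  qbr m n ((uw 2 + uw 1) + (uw 2 + (uw 2 + (uw 1 + uw 0)))) (uw 1)
   (qbr m n (uw 2 + uw 1) (uw 2 + (uw 2 + (uw 1 + uw 0))) (dj10A m n σ)
    (qbr m n (uw 2) (uw 2 + (uw 1 + uw 0)) (fx m n σ 2)
     (qbr m n (uw 2) (uw 1 + uw 0) (fx m n σ 2)
      (qbr m n (uw 1) (uw 0) (fx m n σ 1) (fx m n σ 0)))))
   (fx m n σ 1)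

/-- The defining relations (DJ1)–(DJ11) of `U_q[osp(2m+1|2n)^{(1)}]`. -/
inductive URel (m n : ℕ) : UF m n → UF m n → Prop
  | k_inv (i : ℕ) (hi : i ≤ m + n) : URel m n (fk m n i * fki m n i) 1
  | inv_k (i : ℕ) (hi : i ≤ m + n) : URel m n (fki m n i * fk m n i) 1
  | k_k (i j : ℕ) (hi : i ≤ m + n) (hj : j ≤ m + n) :
      URel m n (fk m n i * fk m n j) (fk m n j * fk m n i)
  | k_x (σ : Bool) (i j : ℕ) (hi : i ≤ m + n) (hj : j ≤ m + n) :
      URel m n (fk m n i * fx m n σ j * fki m n i)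
           ((vv ^ ((if σ then 2 else -2) * Bmat m n i j)) • fx m n σ j)
  | xp_xm (i j : ℕ) (hi : i ≤ m + n) (hj : j ≤ m + n) :
      URel m n (sbr n (uw i) (uw j) (fcp m n i) (fcm m n j))
           (if i = j then (vv ^ qexp m n i - vv ^ (-qexp m n i))⁻¹ • (fk m n i - fki m n i) else 0)
  | x_x (σ : Bool) (i j : ℕ) (hi : i ≤ m + n) (hj : j ≤ m + n) (h0 : Bmat m n i j = 0) :
      URel m n (sbr n (uw i) (uw j) (fx m n σ i) (fx m n σ j)) 0
  | serre_up (σ : Bool) (i : ℕ) (hi : i < m + n) (hn : i ≠ n) :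
      URel m n (qbr m n (uw i) (uw i + uw (i+1)) (fx m n σ i)
             (qbr m n (uw i) (uw (i+1)) (fx m n σ i) (fx m n σ (i+1)))) 0
  | serre_dn (σ : Bool) (i : ℕ) (h1 : 1 < i) (hi : i < m + n) (hn : i ≠ n) :
      URel m n (qbr m n (uw i) (uw i + uw (i-1)) (fx m n σ i)
             (qbr m n (uw i) (uw (i-1)) (fx m n σ i) (fx m n σ (i-1)))) 0
  | serre3 (σ : Bool) (i : ℕ) (hi : i = 1 ∨ i = m + n) :
      URel m n (qbr m n (uw i) (uw i + (uw i + uw (i-1))) (fx m n σ i)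
             (qbr m n (uw i) (uw i + uw (i-1)) (fx m n σ i)
               (qbr m n (uw i) (uw (i-1)) (fx m n σ i) (fx m n σ (i-1))))) 0
  | serre4 (σ : Bool) (hn : 1 < n) :
      URel m n (sbr n (uw (n-1) + uw n + uw (n+1)) (uw n)
             (qbr m n (uw (n-1) + uw n) (uw (n+1))
               (qbr m n (uw (n-1)) (uw n) (fx m n σ (n-1)) (fx m n σ n)) (fx m n σ (n+1)))
             (fx m n σ n)) 0
  | serre5 (σ : Bool) (hn : n = 1) (hm : 2 ≤ m) : URel m n (dj9lhs m n σ) 0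
  | serre6 (σ : Bool) (hn : n = 1) (hm : m = 1) :
      URel m n (dj10lhs m n σ) ((1 - qint m n 1 2) • dj10rhs m n σ)
  | kd_inv : URel m n (fkd m n * fkdi m n) 1
  | inv_kd : URel m n (fkdi m n * fkd m n) 1
  | kd_sq : URel m n (fkd m n * fkd m n)
      (fk m n 0 * ((List.range (m + n)).map (fun i => fk m n (i+1) * fk m n (i+1))).prod)
  | kd_c (y : UGen m n) : URel m n (fkd m n * FreeAlgebra.ι KK y) (FreeAlgebra.ι KK y * fkd m n)
  | kdi_c (y : UGen m n) : URel m n (fkdi m n * FreeAlgebra.ι KK y) (FreeAlgebra.ι KK y * fkdi m n)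

/-- The Drinfeld–Jimbo quantum affine superalgebra `U_q[osp(2m+1|2n)^{(1)}]`. -/
abbrev UAlg (m n : ℕ) : Type := RingQuot (URel m n)

def mkU (m n : ℕ) : UF m n →ₐ[KK] UAlg m n := RingQuot.mkAlgHom KK (URel m n)

def cp (m n : ℕ) (i : ℕ) : UAlg m n := mkU m n (fcp m n i)
def cm (m n : ℕ) (i : ℕ) : UAlg m n := mkU m n (fcm m n i)
def kU (m n : ℕ) (i : ℕ) : UAlg m n := mkU m n (fk m n i)
def kiU (m n : ℕ) (i : ℕ) : UAlg m n := mkU m n (fki m n i)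
def kdU (m n : ℕ) : UAlg m n := mkU m n (fkd m n)
def kdiU (m n : ℕ) : UAlg m n := mkU m n (fkdi m n)

/-- the index sequence of the quantum root vector `𝓔_i`:
`1, …, î, …, N, N, N-1, …, 1, 0`. -/
def eseq (m n i : ℕ) : List ℕ :=
  (((List.range (m + n)).map (· + 1)).filter (· ≠ i)) ++
    ((List.range (m + n)).map (· + 1)).reverse ++ [0]

/-- the quantum root vector `𝓔_i` (of weight `δ - α_i`). -/
def EE (m n i : ℕ) : UAlg m n := qfoldr m n (cp m n) (eseq m n i)

/-- `d_{i}` for `1 ≤ i ≤ N+1`: `(ε_i,ε_i)` for `i ≤ N`, and `d_{N+1} = 1`. -/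
def dd (n i : ℕ) : ℤ := if 1 ≤ i ∧ i ≤ n then -1 else 1

/-- The specification of the anti-automorphism `Ω` (together with the companion field
homomorphism `τ : f(v) ↦ f(v⁻¹)` of `ℂ(v)`). -/
def OmegaSpec (m n : ℕ) (τ : KK →+* KK) (Ω : UAlg m n → UAlg m n) : Prop :=
  (∀ c : ℂ, τ (algebraMap ℂ KK c) = algebraMap ℂ KK c) ∧
  τ vv = vv⁻¹ ∧
  Function.Bijective Ω ∧
  (∀ x y : UAlg m n, Ω (x + y) = Ω x + Ω y) ∧
  (∀ x y : UAlg m n, Ω (x * y) = Ω y * Ω x) ∧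
  (∀ (f : KK) (x : UAlg m n), Ω (f • x) = τ f • Ω x) ∧
  (∀ i ≤ m + n, Ω (cp m n i) = ((dd n (i+1) : ℤ) : KK) • cm m n i) ∧
  (∀ i ≤ m + n, Ω (cm m n i) = ((dd n (i+1) : ℤ) : KK) • cp m n i) ∧
  (∀ i ≤ m + n, Ω (kU m n i) = kiU m n i) ∧
  (∀ i ≤ m + n, Ω (kiU m n i) = kU m n i) ∧
  Ω (kdU m n) = kdiU m n ∧
  Ω (kdiU m n) = kdU m n

/-! ## The bar involution of `ℂ(v)` -/

lemma nonZeroDivisors_le_comap_aeval_inv_vv :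
    nonZeroDivisors (Polynomial ℂ) ≤
      (nonZeroDivisors KK).comap (Polynomial.aeval (vv⁻¹ : KK) : Polynomial ℂ →ₐ[ℂ] KK) := by
  refine nonZeroDivisors_le_comap_nonZeroDivisors_of_injective _
    (transcendental_iff_injective.mp fun h => RatFunc.transcendental_X (K := ℂ) ?_)
  have h' := h.inv
  rwa [inv_inv] at h'

/-- The substitution `f(v) ↦ f(v⁻¹)` of `ℂ(v)`. -/
def bar : KK →ₐ[ℂ] KK :=
  RatFunc.liftAlgHom (Polynomial.aeval (vv⁻¹ : KK)) nonZeroDivisors_le_comap_aeval_inv_vv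

@[simp]
lemma bar_vv : bar vv = vv⁻¹ := by
  have h : bar (algebraMap (Polynomial ℂ) KK Polynomial.X) =
      Polynomial.aeval (vv⁻¹ : KK) (Polynomial.X : Polynomial ℂ) :=
    RatFunc.liftRingHom_algebraMap _ nonZeroDivisors_le_comap_aeval_inv_vv _
  rwa [RatFunc.algebraMap_X, Polynomial.aeval_X] at h

lemma vv_ne_zero : vv ≠ 0 := RatFunc.X_ne_zero

lemma bar_bar (f : KK) : bar (bar f) = f := by
  have h : (bar.comp bar : KK →ₐ[ℂ] KK).toRingHom = RingHom.id KK := by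
    refine IsLocalization.ringHom_ext (nonZeroDivisors (Polynomial ℂ)) ?_
    refine Polynomial.ringHom_ext (fun c => ?_) ?_
    · have hc : algebraMap (Polynomial ℂ) KK (Polynomial.C c) = algebraMap ℂ KK c := by
        rw [RatFunc.algebraMap_C]; rfl
      simp only [RingHom.comp_apply, hc]
      exact (bar.comp bar).commutes c
    · have hX : algebraMap (Polynomial ℂ) KK Polynomial.X = vv := RatFunc.algebraMap_X
      simp only [RingHom.comp_apply, hX]
      change bar (bar vv) = vv
      simp
  exact RingHom.congr_fun h f

lemma bar_vv_zpow (a : ℤ) : bar (vv ^ a) = vv ^ (-a) := by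
  simp [map_zpow₀]

@[simp]
lemma bar_sg (n : ℕ) (a b : ℕ → ℤ) : bar (sg n a b) = sg n a b := by
  simp [sg, map_zpow₀]

lemma sg_mul_self (n : ℕ) (a b : ℕ → ℤ) : sg n a b * sg n a b = 1 := by
  rw [sg, ← mul_zpow]; simp

lemma sg_mul_bar_sg (n : ℕ) (a b : ℕ → ℤ) : sg n a b * bar (sg n a b) = 1 := by
  rw [bar_sg, sg_mul_self]

lemma qcf_mul_bar_qcf (m n : ℕ) (a b : ℕ → ℤ) : qcf m n a b * bar (qcf m n a b) = 1 := by
  rw [qcf, map_mul, bar_sg, bar_vv_zpow, mul_mul_mul_comm, sg_mul_self, one_mul,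
    ← zpow_add₀ vv_ne_zero, add_neg_cancel, zpow_zero]

lemma bar_inv_sub (a : ℤ) :
    bar (vv ^ a - vv ^ (-a))⁻¹ = -(vv ^ a - vv ^ (-a))⁻¹ := by
  rw [map_inv₀, map_sub, bar_vv_zpow, bar_vv_zpow, neg_neg]
  exact (congrArg _ (neg_sub _ _).symm).trans inv_neg

lemma bar_qint (m n i : ℕ) (a : ℤ) : bar (qint m n i a) = qint m n i a := by
  simp only [qint, map_div₀, map_sub, bar_vv_zpow, neg_neg]
  rw [← neg_div_neg_eq, neg_sub, neg_sub]

/-! ## `qcf` is a symmetric bicharacter -/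

lemma sg_comm (n : ℕ) (a b : ℕ → ℤ) : sg n a b = sg n b a := by
  rw [sg, sg, mul_comm]

lemma Bmat_comm (m n i j : ℕ) : Bmat m n i j = Bmat m n j i :=
  Finset.sum_congr rfl fun _ _ => by ring

lemma Bw_comm (m n : ℕ) (a b : ℕ → ℤ) : Bw m n a b = Bw m n b a := by
  rw [Bw, Bw, Finset.sum_comm]
  exact Finset.sum_congr rfl fun i _ => Finset.sum_congr rfl fun j _ => by
    rw [Bmat_comm m n j i]; ring

lemma qcf_comm (m n : ℕ) (a b : ℕ → ℤ) : qcf m n a b = qcf m n b a := by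
  rw [qcf, qcf, sg_comm, Bw_comm]

lemma Bw_add_left (m n : ℕ) (a b c : ℕ → ℤ) : Bw m n (a + b) c = Bw m n a c + Bw m n b c := by
  simp only [Bw, Pi.add_apply, add_mul, Finset.sum_add_distrib]

lemma qcf_add_left (m n : ℕ) (a b c : ℕ → ℤ) :
    qcf m n (a + b) c = qcf m n a c * qcf m n b c := by
  have h1 : sg n (a + b) c = sg n a c * sg n b c := by
    rw [sg, sg, sg, ← zpow_add₀ (by simp), Pi.add_apply, add_mul]
  have h2 : vv ^ (-2 * Bw m n (a + b) c) = vv ^ (-2 * Bw m n a c) * vv ^ (-2 * Bw m n b c) := by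
    rw [← zpow_add₀ vv_ne_zero, Bw_add_left, mul_add]
  rw [qcf, qcf, qcf, h1, h2, mul_mul_mul_comm]

lemma qcf_add_right (m n : ℕ) (a b c : ℕ → ℤ) :
    qcf m n a (b + c) = qcf m n a b * qcf m n a c := by
  rw [qcf_comm, qcf_add_left, qcf_comm m n b, qcf_comm m n c]

/-! ## Opposite algebras twisted by the bar involution -/

/-- The opposite ring of `A`, with scalars acting through `bar`. -/
def BarOp (A : Type*) : Type _ := Aᵐᵒᵖ

namespace BarOp

variable {A : Type*}

/-- The identity map `BarOp A → A`, an anti-homomorphism. -/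
def val (x : BarOp A) : A := MulOpposite.unop x

/-- The identity map `A → BarOp A`. -/
def of (x : A) : BarOp A := MulOpposite.op x

@[simp] lemma val_of (x : A) : val (of x) = x := rfl

lemma val_injective : Function.Injective (val : BarOp A → A) := MulOpposite.unop_injective

variable [Ring A]

instance : Ring (BarOp A) := inferInstanceAs (Ring Aᵐᵒᵖ)

@[simp] lemma val_one : val (1 : BarOp A) = 1 := rfl

@[simp] lemma val_zero : val (0 : BarOp A) = 0 := rfl

@[simp] lemma val_add (x y : BarOp A) : val (x + y) = val x + val y := rfl

@[simp] lemma val_sub (x y : BarOp A) : val (x - y) = val x - val y := rfl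

@[simp] lemma val_mul (x y : BarOp A) : val (x * y) = val y * val x := rfl

variable [Algebra KK A]

instance : Algebra KK (BarOp A) :=
  ((algebraMap KK Aᵐᵒᵖ).comp bar.toRingHom).toAlgebra' fun c _ => Algebra.commutes (bar c) _

@[simp] lemma val_algebraMap (f : KK) : val (algebraMap KK (BarOp A) f) = algebraMap KK A (bar f) :=
  rfl

@[simp] lemma val_smul (f : KK) (x : BarOp A) : val (f • x) = bar f • val x := by
  rw [Algebra.smul_def, val_mul, val_algebraMap, ← Algebra.commutes, ← Algebra.smul_def]

end BarOp

/-! ## The anti-homomorphism on the free algebra -/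

section Omega

variable (m n : ℕ)

/-- The sign `d_{i+1}`, as a scalar. -/
def dsign (i : Fin (m + n + 1)) : KK := ((dd n (i.val + 1) : ℤ) : KK)

lemma dsign_mul_self (i : Fin (m + n + 1)) : dsign m n i * dsign m n i = 1 := by
  unfold dsign dd
  split_ifs <;> simp

@[simp]
lemma bar_dsign (i : Fin (m + n + 1)) : bar (dsign m n i) = dsign m n i := by
  simp [dsign]

/-- The images of the generators of `U` under `Ω`. -/
def omegaGen : UGen m n → UAlg m n
  | .cp i => dsign m n i • mkU m n (FreeAlgebra.ι KK (.cm i))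
  | .cm i => dsign m n i • mkU m n (FreeAlgebra.ι KK (.cp i))
  | .kk i => mkU m n (FreeAlgebra.ι KK (.ki i))
  | .ki i => mkU m n (FreeAlgebra.ι KK (.kk i))
  | .kd => mkU m n (FreeAlgebra.ι KK .kdi)
  | .kdi => mkU m n (FreeAlgebra.ι KK .kd)

/-- `Ω` on the free algebra, as a homomorphism to the twisted opposite algebra. -/
def omegaHom : UF m n →ₐ[KK] BarOp (UAlg m n) :=
  FreeAlgebra.lift KK fun y => BarOp.of (omegaGen m n y)

/-- `Ω` on the free algebra. -/
def omegaFree (x : UF m n) : UAlg m n := (omegaHom m n x).val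

variable {m n}

@[simp] lemma omegaFree_mul (x y : UF m n) :
    omegaFree m n (x * y) = omegaFree m n y * omegaFree m n x := by
  simp [omegaFree]

@[simp] lemma omegaFree_sub (x y : UF m n) :
    omegaFree m n (x - y) = omegaFree m n x - omegaFree m n y := by
  simp [omegaFree]

@[simp] lemma omegaFree_one : omegaFree m n 1 = 1 := by simp [omegaFree]

@[simp] lemma omegaFree_zero : omegaFree m n 0 = 0 := by simp [omegaFree]

@[simp] lemma omegaFree_smul (f : KK) (x : UF m n) :
    omegaFree m n (f • x) = bar f • omegaFree m n x := by
  simp [omegaFree]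

@[simp] lemma omegaFree_ι (y : UGen m n) :
    omegaFree m n (FreeAlgebra.ι KK y) = omegaGen m n y := by
  simp [omegaFree, omegaHom]

@[simp] lemma omegaFree_fk (i : ℕ) : omegaFree m n (fk m n i) = mkU m n (fki m n i) := by
  simp [fk, fki, omegaGen]

@[simp] lemma omegaFree_fki (i : ℕ) : omegaFree m n (fki m n i) = mkU m n (fk m n i) := by
  simp [fk, fki, omegaGen]

@[simp] lemma omegaFree_fkd : omegaFree m n (fkd m n) = mkU m n (fkdi m n) := by
  simp [fkd, fkdi, omegaGen]

@[simp] lemma omegaFree_fkdi : omegaFree m n (fkdi m n) = mkU m n (fkd m n) := by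
  simp [fkd, fkdi, omegaGen]

lemma omegaFree_fcp (i : ℕ) :
    omegaFree m n (fcp m n i) = dsign m n (uidx m n i) • mkU m n (fcm m n i) := by
  simp [fcp, fcm, omegaGen]

lemma omegaFree_fcm (i : ℕ) :
    omegaFree m n (fcm m n i) = dsign m n (uidx m n i) • mkU m n (fcp m n i) := by
  simp [fcp, fcm, omegaGen]

lemma omegaFree_fx (σ : Bool) (i : ℕ) :
    omegaFree m n (fx m n σ i) = dsign m n (uidx m n i) • mkU m n (fx m n (!σ) i) := by
  cases σ
  · exact omegaFree_fcm i
  · exact omegaFree_fcp i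

lemma omegaFree_cbr {c s t : KK} (hc : c * bar c = 1) {x y x' y' : UF m n}
    (hx : omegaFree m n x = s • mkU m n x') (hy : omegaFree m n y = t • mkU m n y') :
    omegaFree m n (cbr c x y) = (-bar c * s * t) • mkU m n (cbr c x' y') := by
  have h : bar c * s * t * c = s * t := by linear_combination s * t * hc
  simp only [cbr, omegaFree_sub, omegaFree_mul, omegaFree_smul, hx, hy, map_sub, map_mul, map_smul,
    smul_mul_smul_comm, smul_sub, smul_smul]
  rw [neg_mul, neg_mul, neg_mul, h, neg_smul, neg_smul, mul_comm t s, mul_assoc (bar c)]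
  abel

lemma omegaFree_qbr {s t : KK} (a b : ℕ → ℤ) {x y x' y' : UF m n}
    (hx : omegaFree m n x = s • mkU m n x') (hy : omegaFree m n y = t • mkU m n y') :
    omegaFree m n (qbr m n a b x y) = (-bar (qcf m n a b) * s * t) • mkU m n (qbr m n a b x' y') :=
  omegaFree_cbr (qcf_mul_bar_qcf m n a b) hx hy

lemma omegaFree_sbr {s t : KK} (a b : ℕ → ℤ) {x y x' y' : UF m n}
    (hx : omegaFree m n x = s • mkU m n x') (hy : omegaFree m n y = t • mkU m n y') :
    omegaFree m n (sbr n a b x y) = (-bar (sg n a b) * s * t) • mkU m n (sbr n a b x' y') :=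
  omegaFree_cbr (sg_mul_bar_sg n a b) hx hy

lemma mkU_rel {x y : UF m n} (h : URel m n x y) : mkU m n x = mkU m n y :=
  RingQuot.mkAlgHom_rel KK h

lemma mkU_surjective : Function.Surjective (mkU m n) := RingQuot.mkAlgHom_surjective KK _

lemma omegaFree_eq_zero {s : KK} {x x' : UF m n} (hx : omegaFree m n x = s • mkU m n x')
    (h : URel m n x' 0) : omegaFree m n x = omegaFree m n 0 := by
  rw [hx, mkU_rel h, map_zero, smul_zero, omegaFree_zero]

lemma omegaFree_prod_fk_mul (l : List ℕ) (hl : ∀ i ∈ l, i < m + n) :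
    mkU m n (l.map fun i => fk m n (i + 1) * fk m n (i + 1)).prod *
      omegaFree m n (l.map fun i => fk m n (i + 1) * fk m n (i + 1)).prod = 1 := by
  induction l with
  | nil => simp
  | cons i l ih =>
    have h : mkU m n (fk m n (i + 1)) * mkU m n (fki m n (i + 1)) = 1 := by
      rw [← map_mul, mkU_rel (.k_inv (i + 1) (hl i (by simp))), map_one]
    simp only [List.map_cons, List.prod_cons, map_mul, omegaFree_mul, omegaFree_fk]
    simp only [mul_assoc]
    rw [← mul_assoc (mkU m n (List.prod _)), ih fun j hj => hl j (by simp [hj]), one_mul,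
      ← mul_assoc (mkU m n (fk m n (i + 1))) (mkU m n (fki m n (i + 1))), h, one_mul, h]

lemma commute_omegaGen {z : UAlg m n}
    (hz : ∀ y : UGen m n, Commute z (mkU m n (FreeAlgebra.ι KK y))) (y : UGen m n) :
    Commute z (omegaGen m n y) := by
  cases y <;> simp only [omegaGen] <;> first | exact hz _ | exact (hz _).smul_right _

lemma omegaFree_dj10lhs (σ : Bool) : ∃ s : KK,
    omegaFree m n (dj10lhs m n σ) = s • mkU m n (dj10lhs m n (!σ)) ∧
    omegaFree m n (dj10rhs m n σ) = s • mkU m n (dj10rhs m n (!σ)) := by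
  have x0 := omegaFree_fx (m := m) (n := n) σ 0
  have x1 := omegaFree_fx (m := m) (n := n) σ 1
  have x2 := omegaFree_fx (m := m) (n := n) σ 2
  have A := omegaFree_qbr (uw 2) (uw 1) x2 x1
  refine ⟨_, omegaFree_qbr _ _ A (omegaFree_qbr _ _ A (omegaFree_qbr _ _ A x0)), ?_⟩
  refine (omegaFree_qbr _ _ (omegaFree_qbr _ _ A (omegaFree_qbr _ _ x2 (omegaFree_qbr _ _ x2
    (omegaFree_qbr _ _ x1 x0)))) x1).trans ?_
  refine congrArg (· • mkU m n (dj10rhs m n (!σ))) ?_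
  simp only [qcf_add_left, qcf_add_right, map_mul, qcf_comm m n (uw 0) (uw 1),
    qcf_comm m n (uw 1) (uw 2)]
  ring

lemma omegaFree_rel ⦃x y : UF m n⦄ (h : URel m n x y) : omegaFree m n x = omegaFree m n y := by
  cases h with
  | k_inv i hi | inv_k i hi =>
    simp only [omegaFree_mul, omegaFree_fk, omegaFree_fki, omegaFree_one, ← map_mul]
    rw [mkU_rel (by first | exact .k_inv i hi | exact .inv_k i hi), map_one]
  | k_k i j hi hj =>
    have hki (a : ℕ) (ha : a ≤ m + n) : mkU m n (fk m n a) * mkU m n (fki m n a) = 1 := by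
      rw [← map_mul, mkU_rel (.k_inv a ha), map_one]
    have hik (a : ℕ) (ha : a ≤ m + n) : mkU m n (fki m n a) * mkU m n (fk m n a) = 1 := by
      rw [← map_mul, mkU_rel (.inv_k a ha), map_one]
    have hkk : mkU m n (fk m n i) * mkU m n (fk m n j) =
        mkU m n (fk m n j) * mkU m n (fk m n i) := by
      rw [← map_mul, mkU_rel (.k_k i j hi hj), map_mul]
    let ui : (UAlg m n)ˣ := ⟨_, _, hki i hi, hik i hi⟩
    let uj : (UAlg m n)ˣ := ⟨_, _, hki j hj, hik j hj⟩
    have hu : Commute ui uj := Units.ext hkk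
    simp only [omegaFree_mul, omegaFree_fk]
    exact congrArg Units.val (hu.inv_inv.symm.eq)
  | k_x σ i j hi hj =>
    have h := mkU_rel (.k_x (!σ) i j hi hj)
    simp only [map_mul, map_smul] at h
    simp only [omegaFree_mul, omegaFree_smul, omegaFree_fk, omegaFree_fki, omegaFree_fx,
      mul_smul_comm, smul_mul_assoc, ← mul_assoc, h, bar_vv_zpow]
    rw [smul_comm]
    cases σ <;> simp
  | xp_xm i j hi hj =>
    have h := mkU_rel (.xp_xm j i hj hi)
    simp only [sbr, cbr, map_sub, map_mul, map_smul] at h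
    simp only [sbr, cbr, omegaFree_sub, omegaFree_mul, omegaFree_smul, omegaFree_fcp,
      omegaFree_fcm, bar_sg, smul_mul_smul_comm]
    rw [smul_comm, mul_comm (dsign m n (uidx m n i)), sg_comm]
    refine (smul_sub _ _ _).symm.trans ((congrArg _ h).trans ?_)
    split_ifs with h1 h2 h2
    · subst h1
      rw [dsign_mul_self, one_smul]
      simp only [map_smul, map_sub, omegaFree_smul, omegaFree_sub, omegaFree_fk, omegaFree_fki,
        bar_inv_sub]
      rw [← neg_sub (mkU m n (fk m n j)), neg_smul_neg]
    · exact absurd h1.symm h2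
    · exact absurd h2.symm h1
    · simp
  | x_x σ i j hi hj h0 =>
    exact omegaFree_eq_zero (omegaFree_sbr _ _ (omegaFree_fx σ i) (omegaFree_fx σ j))
      (.x_x (!σ) i j hi hj h0)
  | serre_up σ i hi hn =>
    exact omegaFree_eq_zero (omegaFree_qbr _ _ (omegaFree_fx σ i)
      (omegaFree_qbr _ _ (omegaFree_fx σ i) (omegaFree_fx σ (i + 1)))) (.serre_up (!σ) i hi hn)
  | serre_dn σ i h1 hi hn =>
    exact omegaFree_eq_zero (omegaFree_qbr _ _ (omegaFree_fx σ i)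
      (omegaFree_qbr _ _ (omegaFree_fx σ i) (omegaFree_fx σ (i - 1)))) (.serre_dn (!σ) i h1 hi hn)
  | serre3 σ i hi =>
    exact omegaFree_eq_zero (omegaFree_qbr _ _ (omegaFree_fx σ i)
      (omegaFree_qbr _ _ (omegaFree_fx σ i)
        (omegaFree_qbr _ _ (omegaFree_fx σ i) (omegaFree_fx σ (i - 1))))) (.serre3 (!σ) i hi)
  | serre4 σ hn =>
    exact omegaFree_eq_zero (omegaFree_sbr _ _ (omegaFree_qbr _ _
      (omegaFree_qbr _ _ (omegaFree_fx σ (n - 1)) (omegaFree_fx σ n)) (omegaFree_fx σ (n + 1)))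
      (omegaFree_fx σ n)) (.serre4 (!σ) hn)
  | serre5 σ hn hm =>
    exact omegaFree_eq_zero (omegaFree_sbr _ _ (omegaFree_qbr _ _ (omegaFree_qbr _ _
      (omegaFree_qbr _ _ (omegaFree_qbr _ _ (omegaFree_qbr _ _ (omegaFree_fx σ 3)
        (omegaFree_fx σ 2)) (omegaFree_fx σ 1)) (omegaFree_fx σ 0)) (omegaFree_fx σ 1))
        (omegaFree_fx σ 2)) (omegaFree_fx σ 1)) (.serre5 (!σ) hn hm)
  | serre6 σ hn hm =>
    obtain ⟨s, hl, hr⟩ := omegaFree_dj10lhs (m := m) (n := n) σ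
    rw [hl, mkU_rel (.serre6 (!σ) hn hm), omegaFree_smul, hr, map_smul, map_sub, map_one, bar_qint,
      smul_comm]
  | kd_inv | inv_kd =>
    simp only [omegaFree_mul, omegaFree_fkd, omegaFree_fkdi, omegaFree_one, ← map_mul]
    rw [mkU_rel (by first | exact .kd_inv | exact .inv_kd), map_one]
  | kd_sq =>
    have hdi : mkU m n (fkdi m n) * mkU m n (fkd m n) = 1 := by
      rw [← map_mul, mkU_rel .inv_kd, map_one]
    have hk0 : mkU m n (fk m n 0) * mkU m n (fki m n 0) = 1 := by
      rw [← map_mul, mkU_rel (.k_inv 0 (Nat.zero_le _)), map_one]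
    have hsq := mkU_rel (URel.kd_sq (m := m) (n := n))
    rw [omegaFree_mul, omegaFree_fkd]
    refine left_inv_eq_right_inv (a := mkU m n (fkd m n * fkd m n)) ?_ ?_
    · rw [map_mul, mul_assoc, ← mul_assoc (mkU m n (fkdi m n)) (mkU m n (fkd m n)), hdi, one_mul,
        hdi]
    · rw [hsq, map_mul, omegaFree_mul, omegaFree_fk, mul_assoc,
        ← mul_assoc (mkU m n (List.prod _)),
        omegaFree_prod_fk_mul _ fun i hi => List.mem_range.mp hi, one_mul, hk0]
  | kd_c y =>
    have h := commute_omegaGen (z := mkU m n (fkdi m n))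
      (fun y => by rw [Commute, SemiconjBy, ← map_mul, mkU_rel (.kdi_c y), map_mul]) y
    simpa using h.eq.symm
  | kdi_c y =>
    have h := commute_omegaGen (z := mkU m n (fkd m n))
      (fun y => by rw [Commute, SemiconjBy, ← map_mul, mkU_rel (.kd_c y), map_mul]) y
    simpa using h.eq.symm

/-! ## The anti-automorphism -/

variable (m n)

/-- The anti-automorphism `Ω` of `U`. -/
def omega (x : UAlg m n) : UAlg m n :=
  (RingQuot.liftAlgHom KK
    ⟨omegaHom m n, fun _ _ h => BarOp.val_injective (omegaFree_rel h)⟩ x).val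

variable {m n}

@[simp] lemma omega_mkU (x : UF m n) : omega m n (mkU m n x) = omegaFree m n x := by
  rw [omega, mkU, RingQuot.liftAlgHom_mkAlgHom_apply, omegaFree]

@[simp] lemma omega_add (x y : UAlg m n) : omega m n (x + y) = omega m n x + omega m n y := by
  simp [omega]

@[simp] lemma omega_mul (x y : UAlg m n) : omega m n (x * y) = omega m n y * omega m n x := by
  simp [omega]

@[simp] lemma omega_smul (f : KK) (x : UAlg m n) : omega m n (f • x) = bar f • omega m n x := by
  simp [omega]

@[simp] lemma omega_algebraMap (f : KK) :
    omega m n (algebraMap KK (UAlg m n) f) = algebraMap KK (UAlg m n) (bar f) := by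
  simp [omega]

lemma omega_omegaGen (y : UGen m n) :
    omega m n (omegaGen m n y) = mkU m n (FreeAlgebra.ι KK y) := by
  cases y <;> simp [omegaGen, smul_smul, dsign_mul_self]

lemma omega_involutive : Function.Involutive (omega m n) := by
  intro x
  obtain ⟨x, rfl⟩ := mkU_surjective x
  induction x using FreeAlgebra.induction with
  | grade0 r => rw [AlgHom.commutes, omega_algebraMap, omega_algebraMap, bar_bar]
  | grade1 y => rw [omega_mkU, omegaFree_ι, omega_omegaGen]
  | mul a b ha hb => rw [map_mul, omega_mul, omega_mul, ha, hb]
  | add a b ha hb => rw [map_add, omega_add, omega_add, ha, hb]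

lemma dsign_uidx {i : ℕ} (hi : i ≤ m + n) :
    dsign m n (uidx m n i) = ((dd n (i + 1) : ℤ) : KK) := by
  simp only [dsign, uidx, Nat.mod_eq_of_lt (Nat.lt_succ_of_le hi)]

end Omega

/-- existence of the `ℂ`-linear anti-automorphism `Ω` of `U`,
semilinear with respect to the field homomorphism `τ : f(v) ↦ f(v⁻¹)` of `ℂ(v)`
(characterized by fixing `ℂ` and sending `v` to `v⁻¹`), with
`Ω(χ_i^±) = d_{i+1} χ_i^∓`, `Ω(K_i^{±1}) = K_i^{∓1}` and `Ω(K_δ^{±1/2}) = K_δ^{∓1/2}`. -/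
theorem exists_antiautomorphism_Omega (m n : ℕ) (hm : 1 ≤ m) (hn : 1 ≤ n) :
    ∃ (τ : KK →+* KK) (Ω : UAlg m n → UAlg m n), OmegaSpec m n τ Ω := by
  refine ⟨bar.toRingHom, omega m n, fun c => bar.commutes c, bar_vv, omega_involutive.bijective,
    omega_add, omega_mul, omega_smul, fun i hi => ?_, fun i hi => ?_, fun i _ => ?_, fun i _ => ?_,
    ?_, ?_⟩
  · rw [cp, omega_mkU, omegaFree_fcp, dsign_uidx hi, cm]
  · rw [cm, omega_mkU, omegaFree_fcm, dsign_uidx hi, cp]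
  · rw [kU, omega_mkU, omegaFree_fk, kiU]
  · rw [kiU, omega_mkU, omegaFree_fki, kU]
  · rw [kdU, omega_mkU, omegaFree_fkd, kdiU]
  · rw [kdiU, omega_mkU, omegaFree_fkdi, kdU]
end
end
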